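/- The 4-form Ω₀ is a calibration on Euclidean ℝ⁸: for every orthonormal quadruple of vectors v₁, v₂, v₃, v₄ ∈ ℝ⁸ one has Ω₀(v₁, v₂, v₃, v₄) ≤ 1 (equivalently |Ω₀(v₁,v₂,v₃,v₄)| ≤ 1), with equality Ω₀ = 1 attained for some orthonormal quadruple, e.g. the first four standard basis vectors. -/

import Mathlib

open scoped RealInnerProductSpace

noncomputable section

/-- ℝ⁸ with its standard Euclidean inner product. -/
abbrev E8 := EuclideanSpace ℝ (Fin 8)

/-- The coordinate 4-form dx_i ∧ dx_j ∧ dx_k ∧ dx_l on ℝ⁸ (indices 0,…,7 for x₁,…,x₈). -/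
def quad8 (i j k l : Fin 8) (a b c d : E8) : ℝ :=
  Matrix.det !![a i, a j, a k, a l; b i, b j, b k, b l;
                c i, c j, c k, c l; d i, d j, d k, d l]

/-- The Spin(7) 4-form Ω₀ = dx₁₂₃₄ + dx₁₂₅₆ + dx₁₂₇₈ + dx₁₃₅₇ − dx₁₃₆₈ − dx₁₄₅₈ − dx₁₄₆₇
    − dx₂₃₅₈ − dx₂₃₆₇ − dx₂₄₅₇ + dx₂₄₆₈ + dx₃₄₅₆ + dx₃₄₇₈ + dx₅₆₇₈. -/
def Omega0 (a b c d : E8) : ℝ :=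
  quad8 0 1 2 3 a b c d + quad8 0 1 4 5 a b c d + quad8 0 1 6 7 a b c d
    + quad8 0 2 4 6 a b c d - quad8 0 2 5 7 a b c d - quad8 0 3 4 7 a b c d
    - quad8 0 3 5 6 a b c d - quad8 1 2 4 7 a b c d - quad8 1 2 5 6 a b c d
    - quad8 1 3 4 6 a b c d + quad8 1 3 5 7 a b c d + quad8 2 3 4 5 a b c d
    + quad8 2 3 6 7 a b c d + quad8 4 5 6 7 a b c d

/-- Octonion multiplication adapted to `Omega0`. -/
def omul (x y : Fin 8 → ℝ) : Fin 8 → ℝ :=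
  ![x 0 * y 0 - x 1 * y 1 - x 2 * y 2 - x 3 * y 3 - x 4 * y 4 - x 5 * y 5 - x 6 * y 6 - x 7 * y 7,
    x 0 * y 1 + x 1 * y 0 + x 2 * y 3 - x 3 * y 2 + x 4 * y 5 - x 5 * y 4 + x 6 * y 7 - x 7 * y 6,
    x 0 * y 2 - x 1 * y 3 + x 2 * y 0 + x 3 * y 1 + x 4 * y 6 - x 5 * y 7 - x 6 * y 4 + x 7 * y 5,
    x 0 * y 3 + x 1 * y 2 - x 2 * y 1 + x 3 * y 0 - x 4 * y 7 - x 5 * y 6 + x 6 * y 5 + x 7 * y 4,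
    x 0 * y 4 - x 1 * y 5 - x 2 * y 6 + x 3 * y 7 + x 4 * y 0 + x 5 * y 1 + x 6 * y 2 - x 7 * y 3,
    x 0 * y 5 + x 1 * y 4 + x 2 * y 7 + x 3 * y 6 - x 4 * y 1 + x 5 * y 0 - x 6 * y 3 - x 7 * y 2,
    x 0 * y 6 - x 1 * y 7 + x 2 * y 4 - x 3 * y 5 - x 4 * y 2 + x 5 * y 3 + x 6 * y 0 + x 7 * y 1,
    x 0 * y 7 + x 1 * y 6 - x 2 * y 5 - x 3 * y 4 + x 4 * y 3 + x 5 * y 2 - x 6 * y 1 + x 7 * y 0]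

/-- Octonion conjugation. -/
def oconj (x : Fin 8 → ℝ) : Fin 8 → ℝ :=
  ![x 0, -x 1, -x 2, -x 3, -x 4, -x 5, -x 6, -x 7]

/-- The standard inner product, written out. -/
def dot8 (x y : Fin 8 → ℝ) : ℝ :=
  x 0 * y 0 + x 1 * y 1 + x 2 * y 2 + x 3 * y 3 + x 4 * y 4 + x 5 * y 5 + x 6 * y 6 + x 7 * y 7

theorem dot8_oconj (x : Fin 8 → ℝ) : dot8 (oconj x) (oconj x) = dot8 x x := by
  simp [dot8, oconj]

/-- The eight-square identity: the norm is multiplicative. -/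
theorem dot8_omul (x y : Fin 8 → ℝ) :
    dot8 (omul x y) (omul x y) = dot8 x x * dot8 y y := by
  simp only [dot8, omul, Matrix.cons_val]
  ring

theorem quad8_eq (i j k l : Fin 8) (a b c d : E8) : quad8 i j k l a b c d =
    (a i * b j - a j * b i) * (c k * d l - c l * d k)
    - (a i * b k - a k * b i) * (c j * d l - c l * d j)
    + (a i * b l - a l * b i) * (c j * d k - c k * d j)
    + (a j * b k - a k * b j) * (c i * d l - c l * d i)
    - (a j * b l - a l * b j) * (c i * d k - c k * d i)
    + (a k * b l - a l * b k) * (c i * d j - c j * d i) := by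
  simp [quad8, Matrix.det_succ_row_zero, Fin.sum_univ_succ, Fin.succAbove]
  ring

set_option maxHeartbeats 4000000 in
theorem Omega0_eq (a b c d : E8) : Omega0 a b c d =
    dot8 a (omul (omul b (oconj c)) d)
      - dot8 b c * dot8 a d + dot8 b d * dot8 a c - dot8 c d * dot8 a b := by
  simp only [Omega0, quad8_eq, dot8, omul, oconj, Matrix.cons_val]
  ring

theorem inner_eq_dot8 (x y : E8) : inner ℝ x y = dot8 x y := by
  simp [PiLp.inner_apply, Fin.sum_univ_eight, dot8]
  ring

theorem dot8_le (x y : Fin 8 → ℝ) (hx : dot8 x x = 1) (hy : dot8 y y = 1) : dot8 x y ≤ 1 := by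
  simp only [dot8] at *
  nlinarith [sq_nonneg (x 0 - y 0), sq_nonneg (x 1 - y 1), sq_nonneg (x 2 - y 2),
    sq_nonneg (x 3 - y 3), sq_nonneg (x 4 - y 4), sq_nonneg (x 5 - y 5),
    sq_nonneg (x 6 - y 6), sq_nonneg (x 7 - y 7)]

/-- Ω₀ is a calibration on ℝ⁸: Ω₀(v₁,v₂,v₃,v₄) ≤ 1 on every orthonormal quadruple, with
equality attained on the orthonormal quadruple (e₁, e₂, e₃, e₄) of standard basis vectors. -/
theorem Omega0_is_calibration :
    (∀ v₁ v₂ v₃ v₄ : E8, Orthonormal ℝ ![v₁, v₂, v₃, v₄] → Omega0 v₁ v₂ v₃ v₄ ≤ 1) ∧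
    Orthonormal ℝ
      ![(EuclideanSpace.single 0 1 : E8), EuclideanSpace.single 1 1,
        EuclideanSpace.single 2 1, EuclideanSpace.single 3 1] ∧
    Omega0 (EuclideanSpace.single 0 1) (EuclideanSpace.single 1 1)
      (EuclideanSpace.single 2 1) (EuclideanSpace.single 3 1) = 1 := by
  refine ⟨?_, ?_, ?_⟩
  · intro a b c d h
    rw [orthonormal_iff_ite] at h
    have haa := h 0 0
    have hbb := h 1 1
    have hcc := h 2 2
    have hdd := h 3 3
    have hbc := (h 1 2).trans (if_neg (by decide))
    have hbd := (h 1 3).trans (if_neg (by decide))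
    have hcd := (h 2 3).trans (if_neg (by decide))
    simp only [Matrix.cons_val, inner_eq_dot8] at haa hbb hcc hdd hbc hbd hcd
    norm_num at haa hbb hcc hdd
    rw [Omega0_eq, hbc, hbd, hcd]
    have := dot8_le a (omul (omul b (oconj c)) d) haa
      (by rw [dot8_omul, dot8_omul, dot8_oconj, hbb, hcc, hdd]; norm_num)
    linarith
  · rw [orthonormal_iff_ite]
    intro i j
    fin_cases i <;> fin_cases j <;> simp [inner_eq_dot8, dot8]
  · simp [Omega0, quad8_eq]
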